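/- arXiv:1205.2394 — 3 statements merged into one kernel-verified Lean document; each statement's English description precedes it below -/
import Mathlib

section
/- Let $n \geq 4$ be even, and let $\varphi : \mathbb{Z}_4 \to \mathrm{Aut}(\mathbb{Z}_n)$ be the homomorphism sending a generator of $\mathbb{Z}_4$ to the inversion automorphism $x \mapsto x^{-1}$. Then the semidirect product $\mathbb{Z}_n \rtimes_{\varphi} \mathbb{Z}_4$ has no faithful complex representation of dimension $2$. -/
/-- The centralizer of a non-scalar `2 × 2` matrix over a field is commutative. -/
theorem Matrix.commute_of_commute_of_forall_ne_scalar {K : Type*} [Field K]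
    {T A B : Matrix (Fin 2) (Fin 2) K} (hT : ∀ t : K, T ≠ Matrix.scalar (Fin 2) t)
    (hA : Commute A T) (hB : Commute B T) : Commute A B := by
  have hne : T 0 1 ≠ 0 ∨ T 1 0 ≠ 0 ∨ T 0 0 - T 1 1 ≠ 0 := by
    by_contra! h
    refine hT (T 0 0) ?_
    ext i j
    fin_cases i <;> fin_cases j <;> simp [h.1, h.2.1, (sub_eq_zero.mp h.2.2).symm]
  have entries {X Y : Matrix (Fin 2) (Fin 2) K} : Commute X Y ↔
      X 0 1 * Y 1 0 = Y 0 1 * X 1 0 ∧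
      (X 0 0 - X 1 1) * Y 0 1 = (Y 0 0 - Y 1 1) * X 0 1 ∧
      (X 0 0 - X 1 1) * Y 1 0 = (Y 0 0 - Y 1 1) * X 1 0 := by
    rw [commute_iff_eq, ← Matrix.ext_iff]
    simp only [Fin.forall_fin_two, Matrix.mul_apply, Fin.sum_univ_two]
    grind
  rw [entries] at hA hB ⊢
  grind

/-- If a group embeds in the `2 × 2` matrices over a field, two elements that both commute with
two distinct commuting involutions commute with each other. -/
theorem commute_of_injective_matrix_two {K G : Type*} [Field K] [Group G]
    {f : G →* Matrix (Fin 2) (Fin 2) K} (hf : Function.Injective f) {z w a b : G}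
    (hz : z * z = 1) (hw : w * w = 1) (hz1 : z ≠ 1) (hw1 : w ≠ 1) (hzw : z ≠ w)
    (haz : Commute a z) (haw : Commute a w) (hbz : Commute b z) (hbw : Commute b w) :
    Commute a b := by
  have scalar_eq {x : G} (hx : x * x = 1) (hx1 : x ≠ 1) {t : K}
      (ht : f x = Matrix.scalar (Fin 2) t) : f x = Matrix.scalar (Fin 2) (-1) := by
    have h : Matrix.scalar (Fin 2) (t * t) = Matrix.scalar (Fin 2) (1 : K) := by
      rw [map_mul, ← ht, ← map_mul, hx, map_one, map_one]
    rcases mul_self_eq_one_iff.mp (Matrix.scalar_inj.mp h) with rfl | rfl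
    · exact absurd (hf (by rw [ht, map_one, map_one])) hx1
    · exact ht
  have of_nonscalar {x : G} (hx : ∀ t : K, f x ≠ Matrix.scalar (Fin 2) t)
      (hax : Commute a x) (hbx : Commute b x) : Commute a b :=
    Commute.of_map hf
      (Matrix.commute_of_commute_of_forall_ne_scalar hx (hax.map f) (hbx.map f))
  by_cases hzs : ∃ t : K, f z = Matrix.scalar (Fin 2) t
  · by_cases hws : ∃ t : K, f w = Matrix.scalar (Fin 2) t
    · obtain ⟨t, ht⟩ := hzs
      obtain ⟨u, hu⟩ := hws
      exact absurd (hf ((scalar_eq hz hz1 ht).trans (scalar_eq hw hw1 hu).symm)) hzw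
    · exact of_nonscalar (not_exists.mp hws) haw hbw
  · exact of_nonscalar (not_exists.mp hzs) haz hbz

theorem no_faithful_two_dim_rep_semidirect (n : ℕ) (hn : 4 ≤ n) (heven : Even n)
    (φ : Multiplicative (ZMod 4) →* MulAut (Multiplicative (ZMod n)))
    (hφ : φ (Multiplicative.ofAdd 1) = MulEquiv.inv (Multiplicative (ZMod n))) :
    ¬ ∃ V : FDRep ℂ (SemidirectProduct (Multiplicative (ZMod n)) (Multiplicative (ZMod 4)) φ),
        Module.finrank ℂ V = 2 ∧ Function.Injective V.ρ := by
  rintro ⟨V, hV, hinj⟩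
  obtain ⟨m, rfl⟩ := heven
  have hm : ((m : ZMod (m + m)) + m) = 0 := by
    rw [← Nat.cast_add, ZMod.natCast_self]
  have hm0 : (m : ZMod (m + m)) ≠ 0 := by
    rw [Ne, ZMod.natCast_eq_zero_iff]
    exact fun h => by have := Nat.le_of_dvd (by omega) h; omega
  have h2 : (1 : ZMod (m + m)) + 1 ≠ 0 := by
    have h : ((2 : ℕ) : ZMod (m + m)) ≠ 0 := by
      rw [Ne, ZMod.natCast_eq_zero_iff]
      exact fun h => by have := Nat.le_of_dvd (by omega) h; omega
    rwa [one_add_one_eq_two, ← Nat.cast_ofNat]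
  have hinv (x : Multiplicative (ZMod (m + m))) : φ (Multiplicative.ofAdd 1) x = x⁻¹ := by
    rw [hφ]; rfl
  have hφ2 : φ (Multiplicative.ofAdd 2) = 1 := by
    have h : (Multiplicative.ofAdd 2 : Multiplicative (ZMod 4)) =
      Multiplicative.ofAdd 1 * Multiplicative.ofAdd 1 := rfl
    ext x
    rw [h, map_mul, MulAut.mul_apply, hinv, hinv, inv_inv, MulAut.one_apply]
  let e := LinearMap.toMatrixAlgEquiv (Module.finBasisOfFinrankEq ℂ V hV)
  let f := (e : (V →ₗ[ℂ] V) →* Matrix (Fin 2) (Fin 2) ℂ).comp V.ρ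
  have hf : Function.Injective f := e.injective.comp hinj
  have hmm : (Multiplicative.ofAdd (m : ZMod (m + m)))⁻¹ = Multiplicative.ofAdd (m : ZMod (m + m)) :=
    inv_eq_of_mul_eq_one_left hm
  have hcomm := commute_of_injective_matrix_two hf
    (z := SemidirectProduct.inl (Multiplicative.ofAdd (m : ZMod (m + m))))
    (w := SemidirectProduct.inr (Multiplicative.ofAdd 2))
    (a := SemidirectProduct.inl (Multiplicative.ofAdd 1))
    (b := SemidirectProduct.inr (Multiplicative.ofAdd 1))
    (by rw [← map_mul, ← ofAdd_add, hm, ofAdd_zero, map_one])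
    (by rw [← map_mul, ← ofAdd_add]; exact map_one _)
    (fun h => hm0 (congrArg SemidirectProduct.left h))
    (fun h => absurd (SemidirectProduct.inr_injective (h.trans (map_one _).symm)) (by decide))
    (fun h => hm0 (congrArg SemidirectProduct.left h))
    ((Commute.all _ _).map _)
    (by ext <;> simp [hφ2])
    (by ext <;> simp [hinv, hmm])
    ((Commute.all _ _).map _)
  have hleft := congrArg SemidirectProduct.left hcomm.eq
  simp only [SemidirectProduct.mul_left, SemidirectProduct.left_inl, SemidirectProduct.left_inr,
    SemidirectProduct.right_inl, SemidirectProduct.right_inr, map_one, mul_one, one_mul,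
    hinv] at hleft
  exact h2 (eq_neg_iff_add_eq_zero.mp hleft)
end

section
/- Let $G$ be a finite group and let $X, X'$ be irreducible finite-dimensional complex representations of $G$. Then the following are equivalent: (i) the representation $X^{*} \otimes X'$ is irreducible; (ii) for every irreducible finite-dimensional complex representation $Y$ of $G$ that is not isomorphic to the trivial representation, either the multiplicity of $Y$ in $X \otimes X^{*}$ is $0$ or the multiplicity of $Y$ in $X' \otimes X'^{*}$ is $0$. -/
open CategoryTheory MonoidalCategory

section Rigid

variable {k C : Type*} [Field k] [Category* C] [Preadditive C] [Linear k C]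
  [MonoidalCategory C] [MonoidalPreadditive C] [MonoidalLinear k C]

/-- `tensorLeftHomEquiv` as a linear equivalence. -/
noncomputable def tensorLeftHomLinearEquiv (X Y Y' Z : C) [ExactPairing Y Y'] :
    (Y' ⊗ X ⟶ Z) ≃ₗ[k] (X ⟶ Y ⊗ Z) :=
  { tensorLeftHomEquiv X Y Y' Z with
    map_add' := fun f g => by simp [tensorLeftHomEquiv]
    map_smul' := fun c f => by simp [tensorLeftHomEquiv] }

/-- `tensorRightHomEquiv` as a linear equivalence. -/
noncomputable def tensorRightHomLinearEquiv (X Y Y' Z : C) [ExactPairing Y Y'] :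
    (X ⊗ Y ⟶ Z) ≃ₗ[k] (X ⟶ Z ⊗ Y') :=
  { tensorRightHomEquiv X Y Y' Z with
    map_add' := fun f g => by simp [tensorRightHomEquiv]
    map_smul' := fun c f => by simp [tensorRightHomEquiv] }

end Rigid

namespace FDRep

variable {G : Type} [Group G]

instance simple_tensorUnit [Finite G] : Simple (𝟙_ (FDRep ℂ G)) := by
  have := Fintype.ofFinite G
  rw [simple_iff_char_is_norm_one]
  have h (g : G) : (𝟙_ (FDRep ℂ G)).character g = 1 := by
    change LinearMap.trace ℂ ℂ LinearMap.id = 1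
    simp
  simp [h]

theorem finrank_unit_hom_tensor_dual (X : FDRep ℂ G) [Simple X] :
    Module.finrank ℂ (𝟙_ (FDRep ℂ G) ⟶ X ⊗ Xᘁ) = 1 := by
  rw [← (tensorRightHomLinearEquiv (k := ℂ) (𝟙_ _) X Xᘁ X).finrank_eq,
    (Linear.homCongr ℂ (λ_ X) (Iso.refl X)).finrank_eq]
  exact finrank_endomorphism_simple_eq_one ℂ X

variable [Finite G]

theorem finrank_hom_comm (V W : FDRep ℂ G) :
    Module.finrank ℂ (V ⟶ W) = Module.finrank ℂ (W ⟶ V) := by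
  have := Fintype.ofFinite G
  have := invertibleOfNonzero (NeZero.ne (Nat.card G : ℂ))
  rw [← Nat.cast_inj (R := ℂ), ← scalar_product_char_eq_finrank_equivariant,
    ← scalar_product_char_eq_finrank_equivariant]
  congr 1
  exact Fintype.sum_equiv (Equiv.inv G) _ _ fun g => by simp [mul_comm]

theorem finrank_end_dual_tensor (X X' : FDRep ℂ G) :
    Module.finrank ℂ (Xᘁ ⊗ X' ⟶ Xᘁ ⊗ X') =
      Module.finrank ℂ (X ⊗ Xᘁ ⟶ X' ⊗ X'ᘁ) := by
  rw [(tensorLeftHomLinearEquiv (k := ℂ) X' X Xᘁ (Xᘁ ⊗ X')).finrank_eq,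
    ← (tensorRightHomLinearEquiv (k := ℂ) (X ⊗ Xᘁ) X' X'ᘁ X').finrank_eq, finrank_hom_comm]
  exact (Linear.homCongr ℂ (α_ X Xᘁ X').symm (Iso.refl X')).finrank_eq

theorem exists_simple_mono (V : FDRep ℂ G) (hV : ¬ Limits.IsZero V) :
    ∃ (Y : FDRep ℂ G) (f : Y ⟶ V), Simple Y ∧ Mono f := by
  induction hn : Module.finrank ℂ (V ⟶ V) using Nat.strong_induction_on generalizing V with
  | _ n ih =>
    by_cases hs : Simple V
    · exact ⟨V, 𝟙 V, hs, inferInstance⟩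
    obtain ⟨W, f, hf, hf0, hfi⟩ : ∃ (W : FDRep ℂ G) (f : W ⟶ V), Mono f ∧ f ≠ 0 ∧ ¬ IsIso f := by
      by_contra! h
      refine hs ⟨fun {W} f hf => ⟨?_, h W f hf⟩⟩
      rintro hi rfl
      exact hV ((Limits.isIsoZero_iff_source_target_isZero _ _).1 hi).2
    let r : V ⟶ W := Injective.factorThru (𝟙 W) f
    have hfr : f ≫ r = 𝟙 W := Injective.comp_factorThru _ _
    let L : (W ⟶ W) →ₗ[ℂ] (V ⟶ V) := Linear.leftComp ℂ V r ∘ₗ Linear.rightComp ℂ W f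
    have hL (φ : W ⟶ W) : L φ = r ≫ φ ≫ f := rfl
    have hinj : Function.Injective L := fun φ ψ h => by
      simpa [hL, reassoc_of% hfr, cancel_mono] using f ≫= h
    have hlt : Module.finrank ℂ (W ⟶ W) < n := by
      rw [← hn]
      refine (LinearMap.finrank_le_finrank_of_injective hinj).lt_of_ne fun h => hfi ?_
      obtain ⟨φ, hφ⟩ := (LinearMap.injective_iff_surjective_of_finrank_eq_finrank h).1 hinj (𝟙 V)
      have : IsSplitEpi f := ⟨⟨⟨r ≫ φ, by simpa [hL] using hφ⟩⟩⟩
      exact isIso_of_mono_of_isSplitEpi f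
    obtain ⟨Y, g, hY, hg⟩ := ih _ hlt W (fun hz => hf0 (hz.eq_zero_of_src f)) rfl
    exact ⟨Y, g ≫ f, hY, mono_comp g f⟩

/-- A nonzero morphism from `A` to `B` is nonzero on some simple subobject of `A`. -/
theorem exists_simple_comp_ne_zero {A B : FDRep ℂ G} {φ : A ⟶ B} (hφ : φ ≠ 0) :
    ∃ (Y : FDRep ℂ G) (h : Y ⟶ A), Simple Y ∧ h ≫ φ ≠ 0 := by
  obtain ⟨Y, i, hY, hi⟩ := exists_simple_mono (Abelian.image φ) fun hz => hφ <| by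
    rw [← Abelian.image.fac φ, hz.eq_zero_of_src (Abelian.image.ι φ), Limits.comp_zero]
  refine ⟨Y, Projective.factorThru i (Abelian.factorThruImage φ), hY, fun h0 => ?_⟩
  have e := Projective.factorThru_comp i (Abelian.factorThruImage φ) =≫ Abelian.image.ι φ
  rw [Category.assoc, Abelian.image.fac, h0] at e
  exact id_nonzero Y ((cancel_mono (i ≫ Abelian.image.ι φ)).1 (by simp [← e]))

theorem finrank_hom_eq_one_iff {A B S : FDRep ℂ G} [Simple S]
    (hA : Module.finrank ℂ (S ⟶ A) = 1) (hB : Module.finrank ℂ (S ⟶ B) = 1) :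
    Module.finrank ℂ (A ⟶ B) = 1 ↔
      ∀ Y : FDRep ℂ G, Simple Y → IsEmpty (Y ≅ S) →
        Module.finrank ℂ (Y ⟶ A) = 0 ∨ Module.finrank ℂ (Y ⟶ B) = 0 := by
  obtain ⟨a, ha0, ha⟩ := finrank_eq_one_iff'.1 hA
  obtain ⟨b, hb0, hb⟩ := finrank_eq_one_iff'.1 hB
  have := mono_of_nonzero_from_simple ha0
  let r : A ⟶ S := Injective.factorThru (𝟙 S) a
  have har : a ≫ r = 𝟙 S := Injective.comp_factorThru _ _
  have hrb : r ≫ b ≠ 0 := fun h => hb0 <| by simpa [reassoc_of% har] using a ≫= h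
  constructor
  · intro h Y hY hYS
    by_contra! hne
    obtain ⟨f, hf⟩ := Module.finrank_pos_iff_exists_ne_zero.1 (Nat.pos_of_ne_zero hne.1)
    obtain ⟨g, hg⟩ := Module.finrank_pos_iff_exists_ne_zero.1 (Nat.pos_of_ne_zero hne.2)
    have := mono_of_nonzero_from_simple hf
    let s : A ⟶ Y := Injective.factorThru (𝟙 Y) f
    have hfs : f ≫ s = 𝟙 Y := Injective.comp_factorThru _ _
    obtain ⟨c, hc⟩ := (finrank_eq_one_iff_of_nonzero' _ hrb).1 h (s ≫ g)
    have hfr : f ≫ r = 0 := by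
      by_contra h0
      have := isIso_of_hom_simple h0
      exact hYS.false (asIso (f ≫ r))
    apply hg
    simpa [reassoc_of% hfs, reassoc_of% hfr] using (f ≫= hc).symm
  · intro h
    refine (finrank_eq_one_iff_of_nonzero' _ hrb).2 fun φ => ?_
    obtain ⟨c, hc⟩ := hb (a ≫ φ)
    refine ⟨c, ?_⟩
    by_contra hne
    obtain ⟨Y, y, hY, hy⟩ := exists_simple_comp_ne_zero (sub_ne_zero.2 hne)
    have hYS : IsEmpty (Y ≅ S) := ⟨fun e => by
      obtain ⟨d, hd⟩ := ha (e.inv ≫ y)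
      apply hy
      have hy' : y = d • e.hom ≫ a := by
        rw [← Linear.comp_smul, hd, Iso.hom_inv_id_assoc]
      simp [hy', reassoc_of% har, ← hc, smul_comm c d]⟩
    rcases h Y hY hYS with h0 | h0
    · exact hy (by rw [Module.finrank_zero_iff.1 h0 |>.elim y 0, Limits.zero_comp])
    · exact hy (Module.finrank_zero_iff.1 h0 |>.elim _ _)

end FDRep

theorem simple_dual_tensor_iff (G : Type) [Group G] [Finite G]
    (X X' : FDRep ℂ G) (hX : Simple X) (hX' : Simple X') :
    Simple (Xᘁ ⊗ X') ↔
      ∀ Y : FDRep ℂ G, Simple Y → IsEmpty (Y ≅ 𝟙_ (FDRep ℂ G)) →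
        Module.finrank ℂ (Y ⟶ X ⊗ Xᘁ) = 0 ∨ Module.finrank ℂ (Y ⟶ X' ⊗ X'ᘁ) = 0 := by
  rw [FDRep.simple_iff_end_is_rank_one, FDRep.finrank_end_dual_tensor]
  exact FDRep.finrank_hom_eq_one_iff (FDRep.finrank_unit_hom_tensor_dual X)
    (FDRep.finrank_unit_hom_tensor_dual X')
end

section
/- Let $G$ be a finite group such that every irreducible finite-dimensional complex representation of $G$ has dimension at most $2$, and let $V$ be an irreducible complex representation of $G$ of dimension $2$. Then the number of isomorphism classes of one-dimensional complex representations $\lambda$ of $G$ with $\lambda \otimes V \cong V$ is either $2$ or $4$; in particular, there exists a nontrivial one-dimensional representation $\lambda$ of $G$ with $\lambda \otimes V \cong V$. -/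
open CategoryTheory MonoidalCategory

namespace Subrepresentation

variable {k G E : Type*} [Field k] [Monoid G] [AddCommGroup E] [Module k E]
  {σ : Representation k G E}

/-- The image in the ambient representation of a subrepresentation of a subrepresentation. -/
def mapSubtype (p : Subrepresentation σ) (q : Subrepresentation p.toRepresentation) :
    Subrepresentation σ where
  toSubmodule := q.toSubmodule.map p.toSubmodule.subtype
  apply_mem_toSubmodule g v hv := by
    obtain ⟨w, hw, rfl⟩ := hv
    exact ⟨p.toRepresentation g w, q.apply_mem_toSubmodule g hw, rfl⟩

lemma mapSubtype_injective (p : Subrepresentation σ) : Function.Injective p.mapSubtype :=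
  fun _ _ h ↦ toSubmodule_injective <|
    Submodule.map_injective_of_injective p.toSubmodule.subtype_injective
      (congrArg toSubmodule h)

lemma mapSubtype_le (p : Subrepresentation σ) (q : Subrepresentation p.toRepresentation) :
    p.mapSubtype q ≤ p := by
  rintro _ ⟨w, -, rfl⟩
  exact w.2

lemma isIrreducible_of_isAtom {p : Subrepresentation σ} (hp : IsAtom p) :
    p.toRepresentation.IsIrreducible := by
  have hbot : p.mapSubtype ⊥ = ⊥ := toSubmodule_injective (Submodule.map_bot _)
  have htop : p.mapSubtype ⊤ = p := toSubmodule_injective (Submodule.map_subtype_top _)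
  have : Nontrivial (Subrepresentation p.toRepresentation) :=
    ⟨⊥, ⊤, fun h ↦ hp.1 (by rw [← htop, ← h, hbot])⟩
  refine ⟨fun q ↦ ?_⟩
  rcases hp.le_iff.1 (p.mapSubtype_le q) with h | h
  · exact .inl (p.mapSubtype_injective (h.trans hbot.symm))
  · exact .inr (p.mapSubtype_injective (h.trans htop.symm))

lemma exists_isAtom_le [FiniteDimensional k E] {p : Subrepresentation σ} (hp : p ≠ ⊥) :
    ∃ a ≤ p, IsAtom a := by
  have hmono : StrictMono (toSubmodule : Subrepresentation σ → Submodule k E) := fun _ _ h ↦ h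
  have : WellFoundedLT (Subrepresentation σ) := hmono.wellFoundedLT
  have : IsAtomic (Subrepresentation σ) := isAtomic_of_orderBot_wellFounded_lt wellFounded_lt
  obtain ⟨a, ha, hap⟩ := (IsAtomic.eq_bot_or_exists_atom_le p).resolve_left hp
  exact ⟨a, hap, ha⟩

/-- A stable line contains a nonzero common eigenvector. -/
lemma exists_eigenvector_of_finrank_eq_one {p : Subrepresentation σ}
    (hp : Module.finrank k p.toSubmodule = 1) :
    ∃ v ∈ p, v ≠ 0 ∧ ∃ χ : G →* k, ∀ g, σ g v = χ g • v := by
  obtain ⟨v, hv, hspan⟩ := finrank_eq_one_iff'.1 hp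
  refine ⟨v, v.2, by simpa using hv, LinearMap.det.comp p.toRepresentation, fun g ↦ ?_⟩
  obtain ⟨c, hc⟩ := hspan (p.toRepresentation g v)
  have hcg : p.toRepresentation g = c • LinearMap.id := by
    refine LinearMap.ext fun w ↦ ?_
    obtain ⟨d, rfl⟩ := hspan w
    rw [map_smul, ← hc, LinearMap.smul_apply, LinearMap.id_apply, smul_comm]
  have hdet : (LinearMap.det.comp p.toRepresentation) g = c := by
    simp [hcg, LinearMap.det_smul, hp]
  rw [hdet]
  exact congrArg Subtype.val hc.symm

/-- A subrepresentation without common eigenvectors has even dimension, if the irreducible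
subrepresentations have dimension at most `2`. -/
lemma even_finrank [FiniteDimensional k E] [σ.IsSemisimpleRepresentation]
    (h : ∀ a : Subrepresentation σ, IsAtom a → Module.finrank k a.toSubmodule ≤ 2)
    (p : Subrepresentation σ)
    (hp : ∀ v ∈ p, ∀ χ : G →* k, (∀ g, σ g v = χ g • v) → v = 0) :
    Even (Module.finrank k p.toSubmodule) := by
  induction hn : Module.finrank k p.toSubmodule using Nat.strong_induction_on generalizing p with
  | _ n ih =>
    subst hn
    by_cases hbot : p = ⊥
    · have : p.toSubmodule = ⊥ := congrArg toSubmodule hbot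
      rw [this, finrank_bot]
      exact Even.zero
    obtain ⟨a, hap, ha⟩ := exists_isAtom_le hbot
    obtain ⟨c, hc⟩ := exists_isCompl a
    have hle : a.toSubmodule ≤ p.toSubmodule := hap
    have hinf : a.toSubmodule ⊓ c.toSubmodule = ⊥ := congrArg toSubmodule hc.inf_eq_bot
    have hsup : a.toSubmodule ⊔ c.toSubmodule = ⊤ := congrArg toSubmodule hc.sup_eq_top
    have hsum := Submodule.finrank_sup_add_finrank_inf_eq a.toSubmodule
      (c.toSubmodule ⊓ p.toSubmodule)
    rw [← sup_inf_assoc_of_le _ hle, hsup, top_inf_eq, ← inf_assoc, hinf, bot_inf_eq,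
      finrank_bot, add_zero] at hsum
    have ha0 : Module.finrank k a.toSubmodule ≠ 0 := fun h0 ↦
      ha.1 (toSubmodule_injective (Submodule.finrank_eq_zero.1 h0))
    have ha1 : Module.finrank k a.toSubmodule ≠ 1 := fun h1 ↦ by
      obtain ⟨v, hv, hv0, χ, hχ⟩ := exists_eigenvector_of_finrank_eq_one h1
      exact hv0 (hp v (hap hv) χ hχ)
    have ha2 := h a ha
    have heven := ih (Module.finrank k ↥(c.toSubmodule ⊓ p.toSubmodule)) (by lia) (c ⊓ p)
      (fun v hv ↦ hp v hv.2) rfl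
    rw [hsum, show Module.finrank k a.toSubmodule = 2 by lia]
    exact even_two.add heven

end Subrepresentation

namespace Representation

variable {k G E : Type*} [Field k]

section Eigenvectors

variable [Monoid G] [AddCommGroup E] [Module k E] {σ : Representation k G E}

/-- Common eigenvectors with pairwise distinct characters are linearly independent. -/
lemma linearIndependent_of_eigenvector {ι : Type*} {χ : ι → G →* k}
    (hχ : Function.Injective χ) {v : ι → E} (hv : ∀ i, v i ≠ 0)
    (h : ∀ i g, σ g (v i) = χ i g • v i) : LinearIndependent k v := by
  have hli : LinearIndependent k (fun i ↦ (χ i : G → k)) :=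
    (linearIndependent_monoidHom G k).comp χ hχ
  rw [linearIndependent_iff'] at hli ⊢
  intro s c hc i hi
  by_contra hci
  obtain ⟨φ, hφ⟩ : ∃ φ : Module.Dual k E, φ (v i) ≠ 0 := by
    by_contra! hall
    exact hv i ((Module.forall_dual_apply_eq_zero_iff k (v i)).1 hall)
  refine mul_ne_zero hci hφ (hli s (fun j ↦ c j * φ (v j)) ?_ i hi)
  ext g
  have := congrArg (fun w ↦ φ (σ g w)) hc
  simp only [map_sum, map_smul, h, map_zero, smul_eq_mul] at this
  simp only [Finset.sum_apply, Pi.smul_apply, smul_eq_mul, Pi.zero_apply, ← this]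
  exact Finset.sum_congr rfl fun j _ ↦ by ring

variable (σ) in
/-- The characters by which the monoid acts on some stable line of a representation. -/
def eigencharacters : Set (G →* k) :=
  {χ | ∃ v, v ≠ 0 ∧ ∀ g, σ g v = χ g • v}

variable (σ) in
lemma finite_eigencharacters [FiniteDimensional k E] : Finite σ.eigencharacters := by
  choose v hv0 hv using fun χ : σ.eigencharacters ↦ χ.2
  exact (linearIndependent_of_eigenvector Subtype.val_injective hv0 hv).finite

/-- If all common eigenspaces are at most one-dimensional and all irreducible subrepresentations
have dimension at most `2`, then the number of eigencharacters has the parity of the dimension. -/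
lemma exists_even_card_eigencharacters_add_eq_finrank [FiniteDimensional k E]
    [σ.IsSemisimpleRepresentation]
    (h : ∀ a : Subrepresentation σ, IsAtom a → Module.finrank k a.toSubmodule ≤ 2)
    (h1 : ∀ (χ : G →* k) (v w : E), v ≠ 0 → (∀ g, σ g v = χ g • v) → (∀ g, σ g w = χ g • w) →
      ∃ c : k, w = c • v) :
    ∃ m, Even m ∧ Nat.card σ.eigencharacters + m = Module.finrank k E := by
  choose v hv0 hv using fun χ : σ.eigencharacters ↦ χ.2
  have hli : LinearIndependent k v :=
    linearIndependent_of_eigenvector Subtype.val_injective hv0 hv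
  have := σ.finite_eigencharacters
  have := Fintype.ofFinite σ.eigencharacters
  let S : Subrepresentation σ :=
    { toSubmodule := Submodule.span k (Set.range v)
      apply_mem_toSubmodule g w hw := by
        induction hw using Submodule.span_induction with
        | mem x hx =>
          obtain ⟨χ, rfl⟩ := hx
          rw [hv]
          exact Submodule.smul_mem _ _ (Submodule.subset_span ⟨χ, rfl⟩)
        | zero => simp
        | add x y _ _ hx hy => rw [map_add]; exact add_mem hx hy
        | smul c x _ hx => rw [map_smul]; exact Submodule.smul_mem _ _ hx }
  obtain ⟨T, hT⟩ := exists_isCompl S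
  have hST : IsCompl S.toSubmodule T.toSubmodule :=
    IsCompl.of_eq (congrArg Subrepresentation.toSubmodule hT.inf_eq_bot)
      (congrArg Subrepresentation.toSubmodule hT.sup_eq_top)
  refine ⟨_, T.even_finrank h fun w hw χ hχ ↦ ?_, ?_⟩
  · by_contra hw0
    obtain ⟨c, hc⟩ := h1 χ _ w (hv0 ⟨χ, w, hw0, hχ⟩) (hv ⟨χ, w, hw0, hχ⟩) hχ
    refine hw0 (Submodule.disjoint_def.1 hST.disjoint w ?_ hw)
    rw [hc]
    exact Submodule.smul_mem _ _ (Submodule.subset_span ⟨_, rfl⟩)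
  · rw [← Submodule.finrank_add_eq_of_isCompl hST, Nat.card_eq_fintype_card,
      ← finrank_span_eq_card hli]

end Eigenvectors

section Irreducible

variable [Group G] [AddCommGroup E] [Module k E] {ρ : Representation k G E}

lemma linHom_apply_eq_smul_iff (χ : G →* k) (f : E →ₗ[k] E) :
    (∀ g, linHom ρ ρ g f = χ g • f) ↔ ∀ g v, ρ g (f v) = χ g • f (ρ g v) := by
  refine forall_congr' fun g ↦ ⟨fun h v ↦ ?_, fun h ↦ LinearMap.ext fun v ↦ ?_⟩
  · have := LinearMap.congr_fun h (ρ g v)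
    simpa [linHom_apply] using this
  · simp [linHom_apply, h]

/-- Schur's lemma for intertwiners up to a character. -/
lemma bijective_of_eigenvector_linHom [FiniteDimensional k E] [ρ.IsIrreducible] {χ : G →* k}
    {f : E →ₗ[k] E} (hf : f ≠ 0) (h : ∀ g, linHom ρ ρ g f = χ g • f) :
    Function.Bijective f := by
  rw [linHom_apply_eq_smul_iff] at h
  let K : Subrepresentation ρ :=
    { toSubmodule := LinearMap.ker f
      apply_mem_toSubmodule g v hv := by
        have hχ : χ g ≠ 0 := ((Group.isUnit g).map χ).ne_zero
        have := h g v
        rw [LinearMap.mem_ker.1 hv, map_zero] at this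
        exact (smul_eq_zero_iff_right hχ).1 this.symm }
  have hK : K = ⊥ := (eq_bot_or_eq_top K).resolve_right fun hK ↦
    hf (LinearMap.ker_eq_top.1 (congrArg Subrepresentation.toSubmodule hK))
  have hinj : Function.Injective f :=
    LinearMap.ker_eq_bot.1 (congrArg Subrepresentation.toSubmodule hK)
  exact ⟨hinj, LinearMap.injective_iff_surjective.1 hinj⟩

lemma exists_eq_smul_of_eigenvector_linHom [IsAlgClosed k] [FiniteDimensional k E]
    [ρ.IsIrreducible] {χ : G →* k}
    {f f' : E →ₗ[k] E} (hf : f ≠ 0) (h : ∀ g, linHom ρ ρ g f = χ g • f)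
    (h' : ∀ g, linHom ρ ρ g f' = χ g • f') : ∃ c : k, f' = c • f := by
  have : Nontrivial E := by
    by_contra hE
    rw [not_nontrivial_iff_subsingleton] at hE
    exact hf (Subsingleton.elim _ _)
  let e := LinearEquiv.ofBijective f (bijective_of_eigenvector_linHom hf h)
  obtain ⟨c, hc⟩ := Module.End.exists_eigenvalue (e.symm.toLinearMap ∘ₗ f')
  obtain ⟨v, hv, hv0⟩ := hc.exists_hasEigenvector
  rw [Module.End.mem_eigenspace_iff] at hv
  refine ⟨c, ?_⟩
  by_contra hne
  refine hv0 ((bijective_of_eigenvector_linHom (ρ := ρ) (χ := χ) (sub_ne_zero.2 hne) fun g ↦ ?_).1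
    (a₁ := v) (a₂ := 0) ?_)
  · rw [map_sub, map_smul, h, h', smul_sub, smul_comm]
  · have : f' v = e (c • v) := by rw [← hv]; simp
    rw [map_zero, LinearMap.sub_apply, this, map_smul]
    simp [e]

end Irreducible

end Representation

lemma Representation.isSemisimpleRepresentation_of_finite {k G E : Type*} [Field k] [Group G]
    [Finite G] [NeZero (Nat.card G : k)] [AddCommGroup E] [Module k E]
    (σ : Representation k G E) : σ.IsSemisimpleRepresentation := by
  rw [isSemisimpleRepresentation_iff_isSemisimpleModule_asModule]
  infer_instance

namespace FDRep

open Representation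

variable {k G : Type} [Field k] [Group G]

lemma nontrivial_of_simple (V : FDRep k G) [Simple V] : Nontrivial V := by
  by_contra hV
  rw [not_nontrivial_iff_subsingleton] at hV
  exact id_nonzero V (by ext x; exact Subsingleton.elim (α := V) _ _)

lemma isIrreducible_of_simple (V : FDRep k G) [Simple V] :
    IsIrreducible (V.ρ : Representation k G V) := by
  have := nontrivial_of_simple V
  refine { exists_pair_ne := ⟨⊥, ⊤, fun h ↦ ?_⟩, eq_bot_or_eq_top := fun p ↦ ?_ }
  · exact bot_ne_top (congrArg Subrepresentation.toSubmodule h)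
  let i : FDRep.of p.toRepresentation ⟶ V :=
    ⟨FGModuleCat.ofHom p.toSubmodule.subtype, fun g ↦ by ext; rfl⟩
  have hi : Mono i := ConcreteCategory.mono_of_injective i Subtype.val_injective
  by_cases h0 : i = 0
  · left
    refine Subrepresentation.toSubmodule_injective ((Submodule.eq_bot_iff _).2 fun v hv ↦ ?_)
    exact congrArg (fun f : FDRep.of p.toRepresentation ⟶ V ↦ f.hom.hom.hom ⟨v, hv⟩) h0
  · right
    have := isIso_of_mono_of_nonzero h0
    refine Subrepresentation.toSubmodule_injective ((Submodule.eq_top_iff').2 fun v ↦ ?_)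
    obtain ⟨w, hw⟩ := (isoToLinearEquiv (asIso i)).surjective v
    rw [← hw]
    exact w.2

lemma simple_of_isIrreducible [IsAlgClosed k] [Finite G] [NeZero (Nat.card G : k)]
    {E : Type} [AddCommGroup E] [Module k E] [FiniteDimensional k E]
    (σ : Representation k G E) [σ.IsIrreducible] : Simple (FDRep.of σ) := by
  rw [simple_iff_end_is_rank_one, ← (forget₂HomLinearEquiv _ _).finrank_eq,
    ← IsIrreducible.finrank_intertwiningMap_self σ]
  exact (Rep.homLinearEquiv _ _).finrank_eq

/-- The representation of a group on the ground field through a character. -/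
noncomputable def ofCharacter (χ : G →* k) : FDRep k G :=
  FDRep.of ((Module.toModuleEnd k k).toMonoidHom.comp χ : Representation k G k)

/-- The determinant character of a representation. -/
noncomputable def detCharacter (V : FDRep k G) : G →* k := LinearMap.det.comp V.ρ

lemma finrank_ofCharacter (χ : G →* k) : Module.finrank k (ofCharacter χ) = 1 :=
  Module.finrank_self k

lemma ρ_apply_of_finrank_eq_one {lam : FDRep k G} (h : Module.finrank k lam = 1) (g : G)
    (v : lam) : lam.ρ g v = lam.detCharacter g • v := by
  obtain ⟨c, hc, -⟩ := (lam.ρ g).existsUnique_eq_smul_id_of_finrank_eq_one h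
  simp [detCharacter, hc, h]

lemma detCharacter_ofCharacter (χ : G →* k) : (ofCharacter χ).detCharacter = χ := by
  ext g
  have : χ g * 1 = (ofCharacter χ).detCharacter g * 1 :=
    ρ_apply_of_finrank_eq_one (finrank_ofCharacter χ) g (1 : k)
  exact (mul_right_cancel₀ one_ne_zero this).symm

lemma detCharacter_tensorUnit : (𝟙_ (FDRep k G)).detCharacter = 1 :=
  MonoidHom.ext fun _ ↦ LinearMap.det_id

/-- An equivariant linear equivalence induces an isomorphism of representations. -/
noncomputable def mkIso {V W : FDRep k G} (e : V ≃ₗ[k] W)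
    (h : ∀ g v, e (V.ρ g v) = W.ρ g (e v)) : V ≅ W :=
  Action.mkIso (LinearEquiv.toFGModuleCatIso e) fun g ↦ by ext v; exact h g v

lemma isoToLinearEquiv_ρ_apply {V W : FDRep k G} (i : V ≅ W) (g : G) (v : V) :
    isoToLinearEquiv i (V.ρ g v) = W.ρ g (isoToLinearEquiv i v) := by
  rw [Iso.conj_ρ i g, LinearEquiv.conj_apply_apply, LinearEquiv.symm_apply_apply]

lemma nonempty_iso_iff_detCharacter_eq {lam mu : FDRep k G} (hlam : Module.finrank k lam = 1)
    (hmu : Module.finrank k mu = 1) :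
    Nonempty (lam ≅ mu) ↔ lam.detCharacter = mu.detCharacter := by
  refine ⟨fun ⟨i⟩ ↦ MonoidHom.ext fun g ↦ ?_, fun h ↦ ?_⟩
  · simp only [detCharacter, MonoidHom.comp_apply]
    rw [Iso.conj_ρ i g]
    exact (LinearMap.det_conj _ _).symm
  · refine ⟨mkIso (LinearEquiv.ofFinrankEq lam mu (hlam.trans hmu.symm)) fun g v ↦ ?_⟩
    rw [ρ_apply_of_finrank_eq_one hlam, ρ_apply_of_finrank_eq_one hmu, map_smul, h]

open TensorProduct in
lemma nonempty_tensor_iso_iff {lam V : FDRep k G} [Simple V] (hlam : Module.finrank k lam = 1) :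
    Nonempty (lam ⊗ V ≅ V) ↔ lam.detCharacter ∈ eigencharacters (linHom V.ρ V.ρ) := by
  have := isIrreducible_of_simple V
  let e₁ : lam ≃ₗ[k] k := LinearEquiv.ofFinrankEq _ _ (hlam.trans (Module.finrank_self k).symm)
  constructor
  · rintro ⟨i⟩
    let e : lam ⊗[k] V ≃ₗ[k] V := isoToLinearEquiv i
    have he (g : G) (l : lam) (v : V) : V.ρ g (e (l ⊗ₜ v)) = e (lam.ρ g l ⊗ₜ V.ρ g v) :=
      (isoToLinearEquiv_ρ_apply i g (l ⊗ₜ[k] v)).symm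
    let l := e₁.symm 1
    refine ⟨e.toLinearMap ∘ₗ TensorProduct.mk k lam V l, fun h0 ↦ ?_,
      (linHom_apply_eq_smul_iff _ _).2 fun g v ↦ ?_⟩
    · have := nontrivial_of_simple V
      obtain ⟨v, hv⟩ := exists_ne (0 : V)
      have hlv : l ⊗ₜ[k] v = 0 := e.map_eq_zero_iff.1 (LinearMap.congr_fun h0 v)
      have := congrArg (TensorProduct.congr e₁ (.refl k V) ≪≫ₗ TensorProduct.lid k V) hlv
      exact hv (by simpa [l] using this)
    · simp only [LinearMap.comp_apply, TensorProduct.mk_apply, LinearEquiv.coe_coe]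
      rw [he, ρ_apply_of_finrank_eq_one hlam, ← TensorProduct.smul_tmul', map_smul]
  · rintro ⟨f, hf, h⟩
    have hbij := bijective_of_eigenvector_linHom hf h
    rw [linHom_apply_eq_smul_iff] at h
    let e : lam ⊗[k] V ≃ₗ[k] V := TensorProduct.congr e₁ (LinearEquiv.ofBijective f hbij) ≪≫ₗ
      TensorProduct.lid k V
    have he (l : lam) (v : V) : e (l ⊗ₜ v) = e₁ l • f v := rfl
    refine ⟨mkIso (V := lam ⊗ V) e fun g x ↦ ?_⟩
    refine TensorProduct.induction_on (R := k) (M := lam) (N := V) x ?_ (fun l v ↦ ?_)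
      (fun x y hx hy ↦ ?_)
    · simp
    · refine (he (lam.ρ g l) (V.ρ g v)).trans ?_
      rw [he, ρ_apply_of_finrank_eq_one hlam, map_smul, map_smul, h, smul_smul, smul_eq_mul,
        mul_comm]
    · rw [map_add, map_add, hx, hy, ← map_add, ← map_add]

/-- Isomorphism classes of one-dimensional representations fixing `V` under tensoring correspond
to the eigencharacters of the conjugation action on endomorphisms of `V`. -/
lemma card_quot_eq_card_eigencharacters (V : FDRep k G) [Simple V] :
    Nat.card (Quot (fun lam mu : {lam : FDRep k G //
      Module.finrank k lam = 1 ∧ Nonempty (lam ⊗ V ≅ V)} => Nonempty (lam.1 ≅ mu.1))) =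
      Nat.card (eigencharacters (linHom V.ρ V.ρ)) := by
  refine Nat.card_congr (Equiv.ofBijective (Quot.lift
    (fun lam ↦ ⟨lam.1.detCharacter, (nonempty_tensor_iso_iff lam.2.1).1 lam.2.2⟩)
    fun lam mu hiso ↦ Subtype.ext
      ((nonempty_iso_iff_detCharacter_eq lam.2.1 mu.2.1).1 hiso)) ⟨?_, ?_⟩)
  · rintro ⟨lam⟩ ⟨mu⟩ heq
    exact Quot.sound
      ((nonempty_iso_iff_detCharacter_eq lam.2.1 mu.2.1).2 (congrArg Subtype.val heq))
  · rintro ⟨χ, hχ⟩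
    refine ⟨Quot.mk _ ⟨ofCharacter χ, finrank_ofCharacter χ, ?_⟩,
      Subtype.ext (detCharacter_ofCharacter χ)⟩
    rwa [nonempty_tensor_iso_iff (finrank_ofCharacter χ), detCharacter_ofCharacter]

end FDRep

theorem card_stabilizing_invertibles (G : Type) [Group G] [Finite G]
    (h : ∀ V : FDRep ℂ G, Simple V → Module.finrank ℂ V ≤ 2)
    (V : FDRep ℂ G) (hV : Simple V) (hV2 : Module.finrank ℂ V = 2) :
    (Nat.card (Quot (fun lam mu : {lam : FDRep ℂ G //
        Module.finrank ℂ lam = 1 ∧ Nonempty (lam ⊗ V ≅ V)} => Nonempty (lam.1 ≅ mu.1))) = 2 ∨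
     Nat.card (Quot (fun lam mu : {lam : FDRep ℂ G //
        Module.finrank ℂ lam = 1 ∧ Nonempty (lam ⊗ V ≅ V)} => Nonempty (lam.1 ≅ mu.1))) = 4) ∧
    ∃ lam : FDRep ℂ G, Module.finrank ℂ lam = 1 ∧
      IsEmpty (lam ≅ 𝟙_ (FDRep ℂ G)) ∧ Nonempty (lam ⊗ V ≅ V) := by
  have hirr := FDRep.isIrreducible_of_simple V
  have := Representation.isSemisimpleRepresentation_of_finite (Representation.linHom V.ρ V.ρ)
  have := Representation.finite_eigencharacters (Representation.linHom V.ρ V.ρ)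
  obtain ⟨m, hm, hcard⟩ :=
    (Representation.linHom V.ρ V.ρ).exists_even_card_eigencharacters_add_eq_finrank
      (fun a ha ↦ by
        have := Subrepresentation.isIrreducible_of_isAtom ha
        exact h _ (FDRep.simple_of_isIrreducible a.toRepresentation))
      (fun χ f f' hf hχ hχ' ↦
        Representation.exists_eq_smul_of_eigenvector_linHom hf hχ hχ')
  rw [Module.finrank_linearMap, hV2] at hcard
  have hone : 1 ∈ Representation.eigencharacters (Representation.linHom V.ρ V.ρ) :=
    have := FDRep.nontrivial_of_simple V
    ⟨LinearMap.id, one_ne_zero (α := Module.End ℂ V),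
      (Representation.linHom_apply_eq_smul_iff _ _).2 fun g v ↦ by simp⟩
  have hpos : Nat.card (Representation.linHom V.ρ V.ρ).eigencharacters ≠ 0 :=
    have : Nonempty (Representation.linHom V.ρ V.ρ).eigencharacters := ⟨1, hone⟩
    Nat.card_pos.ne'
  have hS : Nat.card (Representation.linHom V.ρ V.ρ).eigencharacters = 2 ∨
      Nat.card (Representation.linHom V.ρ V.ρ).eigencharacters = 4 := by
    obtain ⟨r, rfl⟩ := hm
    lia
  refine ⟨?_, ?_⟩
  · rw [FDRep.card_quot_eq_card_eigencharacters V]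
    exact hS
  · have : Nontrivial (Representation.linHom V.ρ V.ρ).eigencharacters := by
      rw [← Finite.one_lt_card_iff_nontrivial]
      lia
    obtain ⟨⟨χ, hχ⟩, hne⟩ := exists_ne
      (⟨1, hone⟩ : Representation.eigencharacters (Representation.linHom V.ρ V.ρ))
    refine ⟨FDRep.ofCharacter χ, FDRep.finrank_ofCharacter χ, ⟨fun i ↦ hne ?_⟩, ?_⟩
    · have := (FDRep.nonempty_iso_iff_detCharacter_eq (FDRep.finrank_ofCharacter χ)
        (Module.finrank_self ℂ)).1 ⟨i⟩
      rw [FDRep.detCharacter_ofCharacter, FDRep.detCharacter_tensorUnit] at this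
      exact Subtype.ext this
    · rwa [FDRep.nonempty_tensor_iso_iff (FDRep.finrank_ofCharacter χ),
        FDRep.detCharacter_ofCharacter]
end
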